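/- Lie bracket of the quantum square of the Euler field with the quantum volume element: [E², Δ] = −2b₁ E∘Δ − 2 G(E)∘Δ, where E² := E∘E and [·,·] is the Lie bracket of vector fields on ℂ^N. -/

import Mathlib

open scoped BigOperators

/-- Points of the small phase space `ℂ^N`. -/
abbrev Pt (N : ℕ) := Fin N → ℂ

/-- Vector fields on `ℂ^N` (components with respect to the basis `γ_α`). -/
abbrev VF (N : ℕ) := Pt N → Pt N

/-- Partial derivative `∂/∂t^α`. -/
noncomputable def pd {N : ℕ} (α : Fin N) (F : Pt N → ℂ) : Pt N → ℂ :=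
  fun t => fderiv ℂ F t (Pi.single α 1)

/-- The `k`-point function `⟨⟨v₁ ⋯ v_k⟩⟩` associated with a generating function `F`. -/
noncomputable def corr {N : ℕ} : (Pt N → ℂ) → List (VF N) → Pt N → ℂ
  | F, [] => F
  | F, v :: vs => fun t => ∑ α, v t α * corr (pd α F) vs t

/-- Constant vector field associated with an element of `ℂ^N`. -/
def cvf {N : ℕ} (x : Pt N) : VF N := fun _ => x

/-- The basis vector field `γ_α`. -/
noncomputable def bas {N : ℕ} (α : Fin N) : VF N := cvf (Pi.single α 1)

/-- The dual basis vector field `γ^α = η^{αβ} γ_β`. -/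
noncomputable def dua {N : ℕ} (ηinv : Matrix (Fin N) (Fin N) ℂ) (α : Fin N) : VF N :=
  cvf (fun β => ηinv α β)

/-- The quantum product `v ∘ w := ⟨⟨v w γ^α⟩⟩₀ γ_α` of two vector fields. -/
noncomputable def qp {N : ℕ} (F : Pt N → ℂ) (ηinv : Matrix (Fin N) (Fin N) ℂ)
    (v w : VF N) : VF N :=
  fun t σ => corr F [v, w, dua ηinv σ] t

/-- The grading operator `G(Σ f_α γ_α) = Σ b_α f_α γ_α`. -/
def Gop {N : ℕ} (b : Fin N → ℂ) (v : VF N) : VF N := fun t α => b α * v t α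

/-- The Euler vector field `E = c + Σ_α (b₁ + 1 - b_α) t^α γ_α`. -/
def euler {N : ℕ} (c : Pt N) (b : Fin N → ℂ) (b1 : ℂ) : VF N :=
  fun t α => c α + (b1 + 1 - b α) * t α

/-- The quantum volume element `Δ := γ^α ∘ γ_α`. -/
noncomputable def qvol {N : ℕ} (F : Pt N → ℂ) (ηinv : Matrix (Fin N) (Fin N) ℂ) : VF N :=
  fun t => ∑ α, qp F ηinv (dua ηinv α) (bas α) t

/-- Covariant derivative `∇_v w` with respect to the trivial connection (`∇ γ_α = 0`). -/
noncomputable def nablaVF {N : ℕ} (v w : VF N) : VF N :=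
  fun t α => fderiv ℂ (fun s => w s α) t (v t)

/-- Derivative of a function along a vector field. -/
noncomputable def dirD {N : ℕ} (v : VF N) (f : Pt N → ℂ) : Pt N → ℂ :=
  fun t => fderiv ℂ f t (v t)

/-- Quantum powers of a vector field: `E⁰ := γ₁`, `E^{k+1} := E ∘ E^k`. -/
noncomputable def epow {N : ℕ} [NeZero N] (F : Pt N → ℂ) (ηinv : Matrix (Fin N) (Fin N) ℂ)
    (E : VF N) : ℕ → VF N
  | 0 => bas 0
  | k + 1 => qp F ηinv E (epow F ηinv E k)

/-- The genus-0 part `G₀` of Getzler's equation. -/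
noncomputable def G0func {N : ℕ} (F0 : Pt N → ℂ) (ηinv : Matrix (Fin N) (Fin N) ℂ)
    (v : Fin 4 → VF N) (t : Pt N) : ℂ :=
  ∑ g : Equiv.Perm (Fin 4),
    ((1/6) * ∑ α, corr F0 [v (g 0), v (g 1), v (g 2), dua ηinv α] t *
        (∑ β, corr F0 [bas α, v (g 3), bas β, dua ηinv β] t)
    + (1/24) * ∑ α, corr F0 [v (g 0), v (g 1), v (g 2), v (g 3), dua ηinv α] t *
        (∑ β, corr F0 [bas α, bas β, dua ηinv β] t)
    - (1/4) * ∑ α, ∑ β, corr F0 [v (g 0), v (g 1), dua ηinv α, dua ηinv β] t *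
        corr F0 [bas α, bas β, v (g 2), v (g 3)] t)

/-- The genus-1 part `G₁` of Getzler's equation. -/
noncomputable def G1func {N : ℕ} (F0 F1 : Pt N → ℂ) (ηinv : Matrix (Fin N) (Fin N) ℂ)
    (v : Fin 4 → VF N) (t : Pt N) : ℂ :=
  ∑ g : Equiv.Perm (Fin 4),
    (3 * corr F1 [qp F0 ηinv (v (g 0)) (v (g 1)), qp F0 ηinv (v (g 2)) (v (g 3))] t
    - 4 * corr F1 [qp F0 ηinv (qp F0 ηinv (v (g 0)) (v (g 1))) (v (g 2)), v (g 3)] t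
    - ∑ α, corr F0 [qp F0 ηinv (v (g 0)) (v (g 1)), v (g 2), v (g 3), dua ηinv α] t *
        corr F1 [bas α] t
    + 2 * ∑ α, corr F0 [v (g 0), v (g 1), v (g 2), dua ηinv α] t *
        corr F1 [qp F0 ηinv (bas α) (v (g 3))] t)

open scoped ContDiff

section Calculus

variable {N : ℕ}

lemma fderiv_apply_eq_sum_pd (f : Pt N → ℂ) (t x : Pt N) :
    fderiv ℂ f t x = ∑ d, x d * pd d f t := by
  conv_lhs => rw [pi_eq_sum_univ' x]
  simp [pd, map_sum]

lemma contDiff_pd {f : Pt N → ℂ} (hf : ContDiff ℂ ∞ f) (a : Fin N) :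
    ContDiff ℂ ∞ (pd a f) :=
  (hf.fderiv_right (m := ∞) (by simp)).clm_apply contDiff_const

lemma pd_comm {f : Pt N → ℂ} (hf : ContDiff ℂ ∞ f) (a b : Fin N) :
    pd a (pd b f) = pd b (pd a f) := by
  funext t
  have hd : DifferentiableAt ℂ (fderiv ℂ f) t :=
    ((hf.fderiv_right (m := ∞) (by simp)).differentiable (by simp)) t
  have key : ∀ a b : Fin N, pd a (pd b f) t
      = fderiv ℂ (fderiv ℂ f) t (Pi.single a 1) (Pi.single b 1) := by
    intro a b
    have h := (hd.hasFDerivAt.clm_apply (hasFDerivAt_const (Pi.single b (1 : ℂ) : Pt N) t)).fderiv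
    change fderiv ℂ (fun s => fderiv ℂ f s (Pi.single b 1)) t (Pi.single a 1) = _
    rw [h]
    simp
  rw [key, key]
  exact (hf.contDiffAt.isSymmSndFDerivAt
    (by simp only [minSmoothness_of_isRCLikeNormedField]; exact WithTop.coe_le_coe.2 le_top)).eq _ _

lemma pd_add {f g : Pt N → ℂ} (hf : ContDiff ℂ ∞ f) (hg : ContDiff ℂ ∞ g) (a : Fin N) :
    pd a (fun t => f t + g t) = fun t => pd a f t + pd a g t := by
  funext t
  simp only [pd]
  rw [fderiv_fun_add (hf.differentiable (by simp) t) (hg.differentiable (by simp) t)]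
  rfl

lemma pd_const_mul {f : Pt N → ℂ} (hf : ContDiff ℂ ∞ f) (k : ℂ) (a : Fin N) :
    pd a (fun t => k * f t) = fun t => k * pd a f t := by
  funext t
  simp only [pd]
  rw [fderiv_const_mul (hf.differentiable (by simp) t)]
  rfl

lemma pd_sum {ι : Type*} [Fintype ι] {f : ι → Pt N → ℂ} (hf : ∀ i, ContDiff ℂ ∞ (f i))
    (a : Fin N) : pd a (fun t => ∑ i, f i t) = fun t => ∑ i, pd a (f i) t := by
  funext t
  simp only [pd]
  rw [fderiv_fun_sum fun i _ => (hf i).differentiable (by simp) t]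
  simp

lemma pd_mul {f g : Pt N → ℂ} (hf : ContDiff ℂ ∞ f) (hg : ContDiff ℂ ∞ g) (a : Fin N) :
    pd a (fun t => f t * g t) = fun t => pd a f t * g t + f t * pd a g t := by
  funext t
  simp only [pd]
  rw [fderiv_fun_mul (hf.differentiable (by simp) t) (hg.differentiable (by simp) t)]
  simp
  ring

lemma pd_coord (a i : Fin N) : pd a (fun t : Pt N => t i) = fun _ => if i = a then 1 else 0 := by
  funext t
  simp only [pd]
  rw [(hasFDerivAt_apply i t).fderiv]
  simp [Pi.single_apply]

lemma pd_const (a : Fin N) (k : ℂ) : pd a (fun _ : Pt N => k) = fun _ => 0 := by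
  funext t
  simp [pd]

lemma contDiff_coord (i : Fin N) : ContDiff ℂ ∞ (fun t : Pt N => t i) := contDiff_apply ℂ ℂ i

lemma contDiff_euler (c : Pt N) (b : Fin N → ℂ) (b1 : ℂ) (i : Fin N) :
    ContDiff ℂ ∞ (fun t => euler c b b1 t i) :=
  contDiff_const.add (contDiff_const.mul (contDiff_coord i))

lemma pd_euler (c : Pt N) (b : Fin N → ℂ) (b1 : ℂ) (a i : Fin N) :
    pd a (fun t => euler c b b1 t i) = fun _ => if i = a then b1 + 1 - b a else 0 := by
  unfold euler
  rw [pd_add contDiff_const (contDiff_const.mul (contDiff_coord i)),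
    pd_const_mul (contDiff_coord i), pd_const, pd_coord]
  funext t
  split_ifs with h <;> simp [h]

lemma contDiff_dirD_euler (c : Pt N) (b : Fin N → ℂ) (b1 : ℂ) {f : Pt N → ℂ}
    (hf : ContDiff ℂ ∞ f) : ContDiff ℂ ∞ (dirD (euler c b b1) f) := by
  have h : dirD (euler c b b1) f = fun t => ∑ i, euler c b b1 t i * pd i f t :=
    funext fun t => fderiv_apply_eq_sum_pd f t _
  rw [h]
  exact ContDiff.sum fun i _ => (contDiff_euler c b b1 i).mul (contDiff_pd hf i)

/-- The commutator of `∂/∂t^a` with the Euler derivation. -/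
lemma pd_dirD_euler (c : Pt N) (b : Fin N → ℂ) (b1 : ℂ) {f : Pt N → ℂ}
    (hf : ContDiff ℂ ∞ f) (a : Fin N) :
    pd a (dirD (euler c b b1) f)
      = fun t => dirD (euler c b b1) (pd a f) t + (b1 + 1 - b a) * pd a f t := by
  have h : ∀ g : Pt N → ℂ, dirD (euler c b b1) g = fun t => ∑ i, euler c b b1 t i * pd i g t :=
    fun g => funext fun t => fderiv_apply_eq_sum_pd g t _
  rw [h, h, pd_sum fun i => (contDiff_euler c b b1 i).mul (contDiff_pd hf i)]
  funext t
  simp only [pd_mul (contDiff_euler c b b1 _) (contDiff_pd hf _), pd_euler, pd_comm hf a,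
    Finset.sum_add_distrib, ite_mul, zero_mul, Finset.sum_ite_eq', Finset.mem_univ, if_true]
  ring

lemma contDiff_quadratic (C : Matrix (Fin N) (Fin N) ℂ) :
    ContDiff ℂ ∞ (fun t : Pt N => ∑ α, ∑ β, C α β * t α * t β) :=
  ContDiff.sum fun i _ => ContDiff.sum fun j _ =>
    (contDiff_const.mul (contDiff_coord i)).mul (contDiff_coord j)

lemma pd_pd_pd_quadratic (C : Matrix (Fin N) (Fin N) ℂ) (i j k : Fin N) :
    pd k (pd j (pd i (fun t : Pt N => ∑ α, ∑ β, C α β * t α * t β))) = fun _ => 0 := by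
  have hl : ∀ α β, ContDiff ℂ ∞ (fun t : Pt N => C α β * t α) := fun α β =>
    contDiff_const.mul (contDiff_coord α)
  have h1 : pd i (fun t : Pt N => ∑ α, ∑ β, C α β * t α * t β)
      = fun t => ∑ β, (C i β + C β i) * t β := by
    rw [pd_sum fun α => ContDiff.sum fun β _ => (hl α β).mul (contDiff_coord β)]
    funext t
    simp only [pd_sum fun β => (hl _ β).mul (contDiff_coord β),
      pd_mul (hl _ _) (contDiff_coord _), pd_const_mul (contDiff_coord _), pd_coord,
      Finset.sum_add_distrib, add_mul]
    simp
  rw [h1, pd_sum fun β => contDiff_const.mul (contDiff_coord β)]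
  simp only [pd_const_mul (contDiff_coord _), pd_coord, pd_const]

/-- The third derivatives of a quasi-homogeneous function are eigenfunctions of the Euler
derivation. -/
lemma dirD_euler_third_pd (c : Pt N) (b : Fin N → ℂ) (b1 : ℂ) (C : Matrix (Fin N) (Fin N) ℂ)
    {F : Pt N → ℂ} (hF : ContDiff ℂ ∞ F)
    (hqh : ∀ t, fderiv ℂ F t (euler c b b1 t)
      = 2 * (b1 + 1) * F t + (1/2) * ∑ α, ∑ β, C α β * t α * t β) (i j k : Fin N) (t : Pt N) :
    dirD (euler c b b1) (pd k (pd j (pd i F))) t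
      = (b i + b j + b k - b1 - 1) * pd k (pd j (pd i F)) t := by
  have hi := contDiff_pd hF i
  have hj := contDiff_pd hi j
  have hk := contDiff_pd hj k
  have hE := fun {f : Pt N → ℂ} (hf : ContDiff ℂ ∞ f) => contDiff_dirD_euler c b b1 hf
  have hQ := contDiff_quadratic C
  have h0 : dirD (euler c b b1) F
      = fun t => 2 * (b1 + 1) * F t + (1/2) * ∑ α, ∑ β, C α β * t α * t β := funext hqh
  have h := congrArg (fun f => pd k (pd j (pd i f)) t) h0
  simp only [pd_dirD_euler c b b1 hF, pd_dirD_euler c b b1 hi, pd_dirD_euler c b b1 hj,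
    pd_add (hE hi) (contDiff_const.mul hi), pd_const_mul hi,
    pd_add ((hE hj).add (contDiff_const.mul hj)) (contDiff_const.mul hj),
    pd_add (hE hj) (contDiff_const.mul hj), pd_const_mul hj,
    pd_add (contDiff_const.mul hF) (contDiff_const.mul hQ), pd_const_mul hF, pd_const_mul hQ,
    pd_add (contDiff_const.mul hi) (contDiff_const.mul (contDiff_pd hQ i)),
    pd_const_mul (contDiff_pd hQ i),
    pd_add (contDiff_const.mul hj) (contDiff_const.mul (contDiff_pd (contDiff_pd hQ i) j)),
    pd_const_mul (contDiff_pd (contDiff_pd hQ i) j), pd_pd_pd_quadratic] at h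
  linear_combination h

end Calculus

section Product

variable {N : ℕ}

lemma qp_apply (F : Pt N → ℂ) (ηinv : Matrix (Fin N) (Fin N) ℂ) (v w : VF N) (t : Pt N)
    (s : Fin N) : qp F ηinv v w t s
      = ∑ i, ∑ j, ∑ k, v t i * w t j * (ηinv s k * pd k (pd j (pd i F)) t) := by
  simp only [qp, corr, dua, cvf, Finset.mul_sum, mul_assoc]

/-- The quantum product on the tangent space at a point. -/
noncomputable def tangentMul (F : Pt N → ℂ) (ηinv : Matrix (Fin N) (Fin N) ℂ) (t : Pt N) :
    Pt N →ₗ[ℂ] Pt N →ₗ[ℂ] Pt N :=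
  LinearMap.mk₂ ℂ (fun u w => qp F ηinv (cvf u) (cvf w) t)
    (fun u u' w => by
      funext s
      simp only [qp_apply, cvf, Pi.add_apply, add_mul, Finset.sum_add_distrib])
    (fun k u w => by
      funext s
      simp only [qp_apply, cvf, Pi.smul_apply, smul_eq_mul, Finset.mul_sum, mul_assoc])
    (fun u w w' => by
      funext s
      simp only [qp_apply, cvf, Pi.add_apply, add_mul, mul_add, Finset.sum_add_distrib])
    (fun k u w => by
      funext s
      simp only [qp_apply, cvf, Pi.smul_apply, smul_eq_mul, Finset.mul_sum, mul_assoc,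
        mul_left_comm k])

lemma qp_eq_tangentMul (F : Pt N → ℂ) (ηinv : Matrix (Fin N) (Fin N) ℂ) (v w : VF N) (t : Pt N) :
    qp F ηinv v w t = tangentMul F ηinv t (v t) (w t) := rfl

lemma tangentMul_apply (F : Pt N → ℂ) (ηinv : Matrix (Fin N) (Fin N) ℂ) (t u w : Pt N)
    (s : Fin N) : tangentMul F ηinv t u w s
      = ∑ i, ∑ j, ∑ k, u i * w j * (ηinv s k * pd k (pd j (pd i F)) t) :=
  qp_apply F ηinv (cvf u) (cvf w) t s

lemma tangentMul_comm {F : Pt N → ℂ} (hF : ContDiff ℂ ∞ F) (ηinv : Matrix (Fin N) (Fin N) ℂ)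
    (t u w : Pt N) : tangentMul F ηinv t u w = tangentMul F ηinv t w u := by
  funext s
  rw [tangentMul_apply, tangentMul_apply, Finset.sum_comm]
  refine Finset.sum_congr rfl fun i _ => Finset.sum_congr rfl fun j _ =>
    Finset.sum_congr rfl fun k _ => ?_
  rw [pd_comm hF i j]
  ring

/-- The derivative `(∇_x ∘)(u, w)` of the quantum product at a point. -/
noncomputable def mulDeriv (F : Pt N → ℂ) (ηinv : Matrix (Fin N) (Fin N) ℂ) (t x u w : Pt N) :
    Pt N :=
  nablaVF (cvf x) (qp F ηinv (cvf u) (cvf w)) t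

/-- Leibniz rule for the quantum product. -/
lemma nablaVF_qp {F : Pt N → ℂ} (hF : ContDiff ℂ ∞ F) (ηinv : Matrix (Fin N) (Fin N) ℂ)
    {v w : VF N} (hv : ∀ i, ContDiff ℂ ∞ fun t => v t i) (hw : ∀ i, ContDiff ℂ ∞ fun t => w t i)
    (x : VF N) (t : Pt N) :
    nablaVF x (qp F ηinv v w) t = mulDeriv F ηinv t (x t) (v t) (w t)
      + tangentMul F ηinv t (nablaVF x v t) (w t) + tangentMul F ηinv t (v t) (nablaVF x w t) := by
  funext s
  have d : ∀ {f : Pt N → ℂ}, ContDiff ℂ ∞ f → HasFDerivAt f (fderiv ℂ f t) t := fun hf =>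
    (hf.differentiable (by simp) t).hasFDerivAt
  have key : ∀ v w : VF N, (∀ i, ContDiff ℂ ∞ fun t => v t i) →
      (∀ i, ContDiff ℂ ∞ fun t => w t i) →
      HasFDerivAt (fun t => qp F ηinv v w t s) _ t := fun v w hv hw => by
    simp only [qp_apply]
    exact HasFDerivAt.fun_sum fun i _ => HasFDerivAt.fun_sum fun j _ =>
      HasFDerivAt.fun_sum fun k _ => ((d (hv i)).mul (d (hw j))).mul
        ((d (contDiff_pd (contDiff_pd (contDiff_pd hF i) j) k)).const_mul (ηinv s k))
  have h1 := (key v w hv hw).fderiv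
  have h2 := (key (cvf (v t)) (cvf (w t)) (fun _ => contDiff_const)
    (fun _ => contDiff_const)).fderiv
  simp only [Pi.add_apply, mulDeriv, tangentMul_apply]
  simp only [nablaVF, h1, h2]
  simp only [cvf, sum_apply, add_apply,
    smul_apply, smul_eq_mul, fderiv_const_apply, Pi.mul_apply,
    zero_apply, ← Finset.sum_add_distrib]
  refine Finset.sum_congr rfl fun i _ => Finset.sum_congr rfl fun j _ =>
    Finset.sum_congr rfl fun k _ => ?_
  ring

lemma contDiff_qp {F : Pt N → ℂ} (hF : ContDiff ℂ ∞ F) (ηinv : Matrix (Fin N) (Fin N) ℂ)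
    {v w : VF N} (hv : ∀ i, ContDiff ℂ ∞ fun t => v t i) (hw : ∀ i, ContDiff ℂ ∞ fun t => w t i)
    (s : Fin N) : ContDiff ℂ ∞ fun t => qp F ηinv v w t s := by
  simp only [qp_apply]
  exact ContDiff.sum fun i _ => ContDiff.sum fun j _ => ContDiff.sum fun k _ =>
    ((hv i).mul (hw j)).mul (contDiff_const.mul (contDiff_pd (contDiff_pd (contDiff_pd hF i) j) k))

lemma nablaVF_cvf (x : VF N) (u t : Pt N) : nablaVF x (cvf u) t = 0 := by
  funext s
  simp [nablaVF, cvf]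

lemma mulDeriv_apply {F : Pt N → ℂ} (hF : ContDiff ℂ ∞ F) (ηinv : Matrix (Fin N) (Fin N) ℂ)
    (t x u w : Pt N) (s : Fin N) : mulDeriv F ηinv t x u w s
      = ∑ i, ∑ j, ∑ k, u i * w j * (ηinv s k * fderiv ℂ (pd k (pd j (pd i F))) t x) := by
  have h3 := fun i j k => contDiff_pd (contDiff_pd (contDiff_pd hF i) j) k
  have h : HasFDerivAt (fun t => qp F ηinv (cvf u) (cvf w) t s)
      (∑ i, ∑ j, ∑ k, (u i * w j) • ηinv s k • fderiv ℂ (pd k (pd j (pd i F))) t) t := by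
    simp only [qp_apply, cvf]
    exact HasFDerivAt.fun_sum fun i _ => HasFDerivAt.fun_sum fun j _ =>
      HasFDerivAt.fun_sum fun k _ => (((h3 i j k).differentiable (by simp) t).hasFDerivAt.const_mul
        (ηinv s k)).const_mul (u i * w j)
  simp only [mulDeriv, nablaVF, h.fderiv, cvf, sum_apply, smul_apply, smul_eq_mul]

lemma mulDeriv_swap_right {F : Pt N → ℂ} (hF : ContDiff ℂ ∞ F)
    (ηinv : Matrix (Fin N) (Fin N) ℂ) (t x u w : Pt N) :
    mulDeriv F ηinv t x u w = mulDeriv F ηinv t x w u := by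
  have h : qp F ηinv (cvf u) (cvf w) = qp F ηinv (cvf w) (cvf u) :=
    funext fun t => tangentMul_comm hF ηinv t u w
  rw [mulDeriv, h, mulDeriv]

lemma mulDeriv_swap_left {F : Pt N → ℂ} (hF : ContDiff ℂ ∞ F)
    (ηinv : Matrix (Fin N) (Fin N) ℂ) (t x u w : Pt N) :
    mulDeriv F ηinv t x u w = mulDeriv F ηinv t u x w := by
  have h : ∀ x u : Pt N, ∀ s, mulDeriv F ηinv t x u w s = ∑ i, ∑ d, ∑ j, ∑ k,
      u i * x d * (w j * (ηinv s k * pd d (pd k (pd j (pd i F))) t)) := fun x u s => by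
    simp only [mulDeriv_apply hF, fderiv_apply_eq_sum_pd, Finset.mul_sum]
    refine Finset.sum_congr rfl fun i _ => ?_
    conv_rhs => rw [Finset.sum_comm]
    refine Finset.sum_congr rfl fun j _ => ?_
    conv_rhs => rw [Finset.sum_comm]
    refine Finset.sum_congr rfl fun k _ => Finset.sum_congr rfl fun d _ => ?_
    ring
  funext s
  rw [h, h, Finset.sum_comm]
  refine Finset.sum_congr rfl fun i _ => Finset.sum_congr rfl fun d _ =>
    Finset.sum_congr rfl fun j _ => Finset.sum_congr rfl fun k _ => ?_
  rw [pd_comm (contDiff_pd (contDiff_pd hF d) j) i k, pd_comm (contDiff_pd hF d) i j,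
    pd_comm hF i d, ← pd_comm (contDiff_pd hF i) d j,
    ← pd_comm (contDiff_pd (contDiff_pd hF i) j) d k]
  ring

/-- The derivative of the associativity equation. -/
lemma mulDeriv_assoc {F : Pt N → ℂ} (hF : ContDiff ℂ ∞ F) (ηinv : Matrix (Fin N) (Fin N) ℂ)
    (hwdvv : ∀ u v w : VF N,
      qp F ηinv (qp F ηinv u v) w = qp F ηinv u (qp F ηinv v w)) (t x u v w : Pt N) :
    mulDeriv F ηinv t x (tangentMul F ηinv t u v) w
        + tangentMul F ηinv t (mulDeriv F ηinv t x u v) w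
      = mulDeriv F ηinv t x u (tangentMul F ηinv t v w)
        + tangentMul F ηinv t u (mulDeriv F ηinv t x v w) := by
  have hc : ∀ (u : Pt N) (i : Fin N), ContDiff ℂ ∞ fun t => cvf u t i := fun _ _ => contDiff_const
  have h := congrArg (fun V => nablaVF (cvf x) V t) (hwdvv (cvf u) (cvf v) (cvf w))
  simp only [nablaVF_qp hF ηinv (contDiff_qp hF ηinv (hc u) (hc v)) (hc w),
    nablaVF_qp hF ηinv (hc u) (contDiff_qp hF ηinv (hc v) (hc w)),
    nablaVF_qp hF ηinv (hc _) (hc _), nablaVF_cvf, map_zero, LinearMap.zero_apply, add_zero] at h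
  exact h

end Product

section Grading

variable {N : ℕ}

/-- The grading operator on a tangent space. -/
def gradingMap (b : Fin N → ℂ) : Pt N →ₗ[ℂ] Pt N where
  toFun v α := b α * v α
  map_add' u v := by funext α; simp [mul_add]
  map_smul' k v := by funext α; simp [mul_left_comm]

lemma mulDeriv_euler {F : Pt N → ℂ} (hF : ContDiff ℂ ∞ F) {ηinv : Matrix (Fin N) (Fin N) ℂ}
    {b : Fin N → ℂ} (hb : ∀ α β, ηinv α β ≠ 0 → b α + b β = 1) (c : Pt N) (b1 : ℂ)
    (C : Matrix (Fin N) (Fin N) ℂ)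
    (hqh : ∀ t, fderiv ℂ F t (euler c b b1 t)
      = 2 * (b1 + 1) * F t + (1/2) * ∑ α, ∑ β, C α β * t α * t β) (t u w : Pt N) :
    mulDeriv F ηinv t (euler c b b1 t) u w
      = tangentMul F ηinv t (gradingMap b u) w + tangentMul F ηinv t u (gradingMap b w)
        - gradingMap b (tangentMul F ηinv t u w) - b1 • tangentMul F ηinv t u w := by
  funext s
  have h := fun i j k => dirD_euler_third_pd c b b1 C hF hqh i j k t
  simp only [dirD] at h
  simp only [mulDeriv_apply hF, h, Pi.add_apply, Pi.sub_apply, Pi.smul_apply, smul_eq_mul,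
    gradingMap, LinearMap.coe_mk, AddHom.coe_mk, tangentMul_apply, Finset.mul_sum,
    ← Finset.sum_add_distrib, ← Finset.sum_sub_distrib]
  refine Finset.sum_congr rfl fun i _ => Finset.sum_congr rfl fun j _ =>
    Finset.sum_congr rfl fun k _ => ?_
  by_cases hz : ηinv s k = 0
  · simp [hz]
  · linear_combination u i * w j * ηinv s k * pd k (pd j (pd i F)) t * hb s k hz

end Grading

section Casimir

variable {N : ℕ} {ηinv : Matrix (Fin N) (Fin N) ℂ}

lemma sum_casimir (ηinv : Matrix (Fin N) (Fin N) ℂ) (B : Pt N →ₗ[ℂ] Pt N →ₗ[ℂ] Pt N) :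
    ∑ α, B (fun β => ηinv α β) (Pi.single α 1)
      = ∑ α, ∑ β, ηinv α β • B (Pi.single β 1) (Pi.single α 1) := by
  refine Finset.sum_congr rfl fun α _ => ?_
  conv_lhs => rw [pi_eq_sum_univ' (fun β => ηinv α β)]
  simp [map_sum, LinearMap.sum_apply]

lemma casimir_symm (hη : ηinv.IsSymm) (B : Pt N →ₗ[ℂ] Pt N →ₗ[ℂ] Pt N) :
    ∑ α, B (fun β => ηinv α β) (Pi.single α 1) = ∑ α, B (Pi.single α 1) (fun β => ηinv α β) := by
  have h := sum_casimir ηinv B.flip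
  simp only [LinearMap.flip_apply] at h
  rw [h, sum_casimir, Finset.sum_comm]
  simp only [hη.apply]

lemma casimir_grading {b : Fin N → ℂ} (hb : ∀ α β, ηinv α β ≠ 0 → b α + b β = 1)
    (B : Pt N →ₗ[ℂ] Pt N →ₗ[ℂ] Pt N) :
    ∑ α, B (gradingMap b fun β => ηinv α β) (Pi.single α 1)
        + ∑ α, B (fun β => ηinv α β) (gradingMap b (Pi.single α 1))
      = ∑ α, B (fun β => ηinv α β) (Pi.single α 1) := by
  have hG : ∀ α : Fin N, gradingMap b (Pi.single α 1) = b α • (Pi.single α 1 : Pt N) := fun α => by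
    funext β
    by_cases h : β = α
    · subst h; simp [gradingMap]
    · simp [gradingMap, h]
  have h1 := sum_casimir ηinv (B.compl₁₂ (gradingMap b) LinearMap.id)
  have h2 := sum_casimir ηinv (B.compl₁₂ LinearMap.id (gradingMap b))
  simp only [LinearMap.compl₁₂_apply, LinearMap.id_apply] at h1 h2
  rw [h1, h2, sum_casimir]
  simp only [hG, map_smul, LinearMap.smul_apply, ← Finset.sum_add_distrib]
  refine Finset.sum_congr rfl fun α _ => Finset.sum_congr rfl fun β _ => ?_
  by_cases hz : ηinv α β = 0
  · simp [hz]
  · rw [smul_smul, smul_smul, ← add_smul, ← mul_add, add_comm (b β), hb α β hz, mul_one]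

lemma sum_comm_pairs {A ι : Type*} [AddCommMonoid A] [Fintype ι] (f : ι → ι → ι → ι → A) :
    ∑ a, ∑ b, ∑ c, ∑ d, f a b c d = ∑ a, ∑ b, ∑ c, ∑ d, f c d b a := by
  have h : ∑ p : ι × ι, ∑ q : ι × ι, f p.1 p.2 q.1 q.2 = ∑ q : ι × ι, ∑ p : ι × ι,
      f p.1 p.2 q.1 q.2 := Finset.sum_comm
  simp only [Fintype.sum_prod_type] at h
  rw [h, Finset.sum_comm]

/-- Quantum multiplication is self-adjoint. -/
lemma casimir_tangentMul {F : Pt N → ℂ} (hF : ContDiff ℂ ∞ F) (t x : Pt N)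
    (B : Pt N →ₗ[ℂ] Pt N →ₗ[ℂ] Pt N) (hη : ηinv.IsSymm) :
    ∑ α, B (tangentMul F ηinv t x fun β => ηinv α β) (Pi.single α 1)
      = ∑ α, B (fun β => ηinv α β) (tangentMul F ηinv t x (Pi.single α 1)) := by
  have hM : ∀ β : Fin N, tangentMul F ηinv t x (Pi.single β 1)
      = ∑ s, (∑ k, ηinv s k * fderiv ℂ (pd k (pd β F)) t x) • (Pi.single s 1 : Pt N) := fun β => by
    rw [← pi_eq_sum_univ']
    funext s
    simp only [tangentMul_apply, fderiv_apply_eq_sum_pd, Finset.mul_sum]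
    rw [Finset.sum_comm, Finset.sum_eq_single β]
    · rw [Finset.sum_comm]
      refine Finset.sum_congr rfl fun k _ => Finset.sum_congr rfl fun i _ => ?_
      rw [pd_comm hF β i, pd_comm (contDiff_pd hF β) i k, Pi.single_eq_same]
      ring
    · intro j _ hj
      simp [hj]
    · simp
  have h1 := sum_casimir ηinv (B.compl₁₂ (tangentMul F ηinv t x) LinearMap.id)
  have h2 := sum_casimir ηinv (B.compl₁₂ LinearMap.id (tangentMul F ηinv t x))
  simp only [LinearMap.compl₁₂_apply, LinearMap.id_apply] at h1 h2
  rw [h1, h2]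
  simp only [hM, map_sum, map_smul, LinearMap.sum_apply, LinearMap.smul_apply, Finset.smul_sum,
    Finset.sum_smul, smul_smul]
  rw [sum_comm_pairs]
  refine Finset.sum_congr rfl fun α _ => Finset.sum_congr rfl fun β _ =>
    Finset.sum_congr rfl fun s _ => Finset.sum_congr rfl fun k _ => ?_
  rw [pd_comm hF α k, hη.apply α β]
  congr 1
  ring

end Casimir

/-- The pointwise algebraic identity behind the bracket of `E∘E` with the quantum volume
element. -/
lemma sum_deriv_sq_sub_deriv_casimir {V ι : Type*} [AddCommGroup V] [Module ℂ V] [Fintype ι]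
    (M : V →ₗ[ℂ] V →ₗ[ℂ] V) (D : V → V → V → V) (G : V →ₗ[ℂ] V) (E : V) (k : ℂ) (u w : ι → V)
    (hcomm : ∀ x y, M x y = M y x) (hassoc : ∀ x y z, M (M x y) z = M x (M y z))
    (hDr : ∀ x y z, D x y z = D x z y) (hDl : ∀ x y z, D x y z = D y x z)
    (hD : ∀ x y z v, D x (M y z) v + M (D x y z) v = D x y (M z v) + M y (D x z v))
    (hE : ∀ x y, D E x y = M (G x) y + M x (G y) - G (M x y) - k • M x y)
    (hsymm : ∀ B : V →ₗ[ℂ] V →ₗ[ℂ] V, ∑ i, B (u i) (w i) = ∑ i, B (w i) (u i))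
    (hG : ∀ B : V →ₗ[ℂ] V →ₗ[ℂ] V,
      ∑ i, B (G (u i)) (w i) + ∑ i, B (u i) (G (w i)) = ∑ i, B (u i) (w i))
    (hM : ∀ B : V →ₗ[ℂ] V →ₗ[ℂ] V, ∑ i, B (M E (u i)) (w i) = ∑ i, B (u i) (M E (w i)))
    (Δ : V) (hΔ : Δ = ∑ i, M (u i) (w i)) :
    ∑ i, D (M E E) (u i) (w i) - (D Δ E E + (2 : ℂ) • M E ((k + 1) • Δ - G Δ))
      = (-(2 * k)) • M E Δ - (2 : ℂ) • M (G E) Δ := by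
  have hGu : ∑ i, M (G (u i)) (w i) = (1/2 : ℂ) • Δ := by
    have h1 := hsymm (M.compl₁₂ G LinearMap.id)
    simp only [LinearMap.compl₁₂_apply, LinearMap.id_apply] at h1
    have h2 := hG M
    simp only [hcomm _ (G _)] at h2
    rw [← h1, ← hΔ] at h2
    rw [← h2, ← two_smul ℂ, smul_smul]
    norm_num
  have hGw : ∑ i, M (u i) (G (w i)) = (1/2 : ℂ) • Δ := by
    have h2 := hG M
    rw [hGu, ← hΔ] at h2
    rw [← sub_eq_of_eq_add' h2.symm]
    module
  have hMGu : ∑ i, M (G (M E (u i))) (w i) = (1/2 : ℂ) • M E Δ := by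
    have h := hM (M.compl₁₂ G LinearMap.id)
    simp only [LinearMap.compl₁₂_apply, LinearMap.id_apply] at h
    rw [h, ← map_smul, ← hGu, map_sum]
    refine Finset.sum_congr rfl fun i _ => ?_
    rw [hcomm, hassoc, hcomm (w i)]
  have hMGw : ∑ i, M (u i) (G (M E (w i))) = (1/2 : ℂ) • M E Δ := by
    have h := hM (M.compl₁₂ LinearMap.id G)
    simp only [LinearMap.compl₁₂_apply, LinearMap.id_apply] at h
    rw [← h, ← map_smul, ← hGw, map_sum]
    exact Finset.sum_congr rfl fun i _ => hassoc _ _ _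
  have hterm : ∀ i, D (M E E) (u i) (w i)
      = M E (M (G (u i)) (w i)) + M E (M (u i) (G (w i))) + M (u i) (G (M E (w i)))
        + M (G (M E (u i))) (w i) - G (M E (M (u i) (w i))) - M E (G (M (u i) (w i)))
        - M (G E) (M (u i) (w i)) - k • M E (M (u i) (w i)) := fun i => by
    have h := hD (u i) E E (w i)
    have hleft : ∀ x y, M x (M E y) = M E (M x y) := fun x y => by
      rw [← hassoc, hcomm x, hassoc]
    rw [hDl (u i) E E, hDl (u i) E (M E (w i)), hDl (u i) E (w i), hDr E (u i) E, hE, hE, hE] at h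
    rw [hDl (M E E), eq_sub_of_add_eq h]
    simp only [map_add, map_sub, map_smul, LinearMap.add_apply, LinearMap.sub_apply,
      LinearMap.smul_apply, hassoc, hleft]
    abel
  simp only [hterm, Finset.sum_add_distrib, Finset.sum_sub_distrib, ← map_sum, ← Finset.smul_sum,
    hGu, hGw, hMGu, hMGw, ← hΔ]
  rw [hDl Δ E E, hDr E Δ E, hE, hcomm _ (G Δ), hcomm (G Δ) E]
  simp only [map_sub, map_smul]
  module

/-- Lie bracket of the quantum square of the Euler field with the quantum volume element:
`[E², Δ] = −2b₁ E∘Δ − 2 G(E)∘Δ`. -/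
theorem lie_bracket_euler_sq_qvol
    {N : ℕ} [NeZero N]
    (ηm ηinv : Matrix (Fin N) (Fin N) ℂ)
    (hηsym : ηm.IsSymm)
    (hη1 : ηm * ηinv = 1) (hη2 : ηinv * ηm = 1)
    (b : Fin N → ℂ)
    (hb : ∀ α β, ηinv α β ≠ 0 → b α + b β = 1)
    (c : Pt N) (C : Matrix (Fin N) (Fin N) ℂ) (hC : C.IsSymm)
    (F0 : Pt N → ℂ)
    (hF0 : ∀ t, AnalyticAt ℂ F0 t)
    (hid : ∀ v : VF N, qp F0 ηinv (bas 0) v = v)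
    (hwdvv : ∀ u v w : VF N,
      qp F0 ηinv (qp F0 ηinv u v) w = qp F0 ηinv u (qp F0 ηinv v w))
    (hqh0 : ∀ t, fderiv ℂ F0 t (euler c b (b 0) t)
      = 2 * (b 0 + 1) * F0 t + (1/2) * ∑ α, ∑ β, C α β * t α * t β) :
    ∀ t : Pt N,
      nablaVF (qp F0 ηinv (euler c b (b 0)) (euler c b (b 0))) (qvol F0 ηinv) t
        - nablaVF (qvol F0 ηinv) (qp F0 ηinv (euler c b (b 0)) (euler c b (b 0))) t
      = (-(2 * b 0)) • qp F0 ηinv (euler c b (b 0)) (qvol F0 ηinv) t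
        - (2 : ℂ) • qp F0 ηinv (Gop b (euler c b (b 0))) (qvol F0 ηinv) t := by
  intro t
  have hF : ContDiff ℂ ∞ F0 := (show AnalyticOnNhd ℂ F0 Set.univ from fun t _ => hF0 t).contDiff
  have hη : ηinv.IsSymm := by
    have h : ηinv.transpose * ηm = 1 := by
      simpa [Matrix.transpose_mul, hηsym.eq] using congrArg Matrix.transpose hη1
    exact left_inv_eq_right_inv h hη1
  have hdua : ∀ α i : Fin N, ContDiff ℂ ∞ fun t => dua ηinv α t i := fun _ _ => contDiff_const
  have hbas : ∀ α i : Fin N, ContDiff ℂ ∞ fun t => bas α t i := fun _ _ => contDiff_const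
  have hvol : nablaVF (qp F0 ηinv (euler c b (b 0)) (euler c b (b 0))) (qvol F0 ηinv) t
      = ∑ α, mulDeriv F0 ηinv t (tangentMul F0 ηinv t (euler c b (b 0) t) (euler c b (b 0) t))
          (fun β => ηinv α β) (Pi.single α 1) := by
    have h : ∀ x : VF N, nablaVF x (qvol F0 ηinv) t
        = ∑ α, nablaVF x (qp F0 ηinv (dua ηinv α) (bas α)) t := fun x => by
      funext s
      simp only [nablaVF, qvol, Finset.sum_apply]
      rw [fderiv_fun_sum fun α _ =>
        (contDiff_qp hF ηinv (hdua α) (hbas α) s).differentiable (by simp) t, sum_apply]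
    rw [h]
    refine Finset.sum_congr rfl fun α _ => ?_
    rw [nablaVF_qp hF ηinv (hdua α) (hbas α), dua, bas, nablaVF_cvf, nablaVF_cvf, map_zero,
      map_zero, LinearMap.zero_apply, add_zero, add_zero, qp_eq_tangentMul]
    simp only [cvf]
  have hnE : nablaVF (qvol F0 ηinv) (euler c b (b 0)) t
      = (b 0 + 1) • qvol F0 ηinv t - gradingMap b (qvol F0 ηinv t) := by
    funext i
    have h : ∀ d, pd d (fun t => euler c b (b 0) t i) t = _ := fun d =>
      congrFun (pd_euler c b (b 0) d i) t
    simp only [nablaVF, fderiv_apply_eq_sum_pd, h, mul_ite, mul_zero, Finset.sum_ite_eq,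
      Finset.mem_univ, if_true, gradingMap, Pi.sub_apply, Pi.smul_apply, smul_eq_mul,
      LinearMap.coe_mk, AddHom.coe_mk]
    ring
  have hEsq : nablaVF (qvol F0 ηinv) (qp F0 ηinv (euler c b (b 0)) (euler c b (b 0))) t
      = mulDeriv F0 ηinv t (qvol F0 ηinv t) (euler c b (b 0) t) (euler c b (b 0) t)
        + (2 : ℂ) • tangentMul F0 ηinv t (euler c b (b 0) t)
          ((b 0 + 1) • qvol F0 ηinv t - gradingMap b (qvol F0 ηinv t)) := by
    rw [nablaVF_qp hF ηinv (contDiff_euler c b (b 0)) (contDiff_euler c b (b 0)), hnE,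
      tangentMul_comm hF ηinv t _ (euler c b (b 0) t), two_smul, add_assoc]
  have hΔ : qvol F0 ηinv t
      = ∑ α, tangentMul F0 ηinv t (fun β => ηinv α β) (Pi.single α 1) := by
    simp only [qvol, qp_eq_tangentMul, dua, bas, cvf]
  have hassoc : ∀ x y z, tangentMul F0 ηinv t (tangentMul F0 ηinv t x y) z
      = tangentMul F0 ηinv t x (tangentMul F0 ηinv t y z) := fun x y z => by
    simpa only [qp_eq_tangentMul, cvf] using congrFun (hwdvv (cvf x) (cvf y) (cvf z)) t
  have hGE : Gop b (euler c b (b 0)) t = gradingMap b (euler c b (b 0) t) := rfl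
  rw [hvol, hEsq, qp_eq_tangentMul, qp_eq_tangentMul, hGE]
  exact sum_deriv_sq_sub_deriv_casimir (tangentMul F0 ηinv t) (mulDeriv F0 ηinv t) (gradingMap b)
    (euler c b (b 0) t) (b 0) (fun α β => ηinv α β) (fun α => Pi.single α 1)
    (tangentMul_comm hF ηinv t)
    hassoc
    (mulDeriv_swap_right hF ηinv t) (mulDeriv_swap_left hF ηinv t)
    (mulDeriv_assoc hF ηinv hwdvv t)
    (mulDeriv_euler hF hb c (b 0) C hqh0 t)
    (casimir_symm hη) (casimir_grading hb)
    (fun B => casimir_tangentMul hF t _ B hη) (qvol F0 ηinv t) hΔ
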